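/- arXiv:2006.01944 — 2 statements merged into one kernel-verified Lean document; each statement's English description precedes it below -/
import Mathlib

section
/- (Lemma 3.2.) Let 0 < γ < 1/2, let d be a positive natural number, let μG be a vector in ℝ^d, and let S, L, S' be finite nonempty multisets of vectors in ℝ^d such that |L| ≤ |S|, |L| ≤ 2γ·|S|, (1 − 2γ)·|S| ≤ |S'|, and ‖μ^L − μG‖₂ ≤ √(log(|S|/|L|)) + √(γ·|S|/|L|). Then (|L|/|S'|)·‖μ^L − μG‖₂ ≤ (√2·γ + √(2γ))/(1 − 2γ). -/
/-- Empirical mean of a finite multiset of vectors in `ℝ^d`. -/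
noncomputable def emean {d : ℕ} (F : Multiset (EuclideanSpace ℝ (Fin d))) :
    EuclideanSpace ℝ (Fin d) :=
  ((Multiset.card F : ℝ))⁻¹ • F.sum

theorem mul_sqrt_log_inv_add_sqrt_div_le {t γ : ℝ} (ht : 0 < t) (hγ : 0 < γ)
    (htγ : t ≤ 2 * γ) (ht1 : t ≤ 1) :
    t * (Real.sqrt (Real.log t⁻¹) + Real.sqrt (γ / t))
      ≤ Real.sqrt 2 * γ + Real.sqrt (2 * γ) := by
  have hlog : Real.log t⁻¹ ≤ t⁻¹ := by
    linarith [Real.log_le_sub_one_of_pos (inv_pos.mpr ht)]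
  have hlog0 : 0 ≤ Real.log t⁻¹ := Real.log_nonneg (one_le_inv₀ ht |>.mpr ht1)
  have h₁ : t * Real.sqrt (Real.log t⁻¹) ≤ Real.sqrt (2 * γ) := by
    apply Real.le_sqrt_of_sq_le
    rw [mul_pow, Real.sq_sqrt hlog0]
    calc t ^ 2 * Real.log t⁻¹ ≤ t ^ 2 * t⁻¹ := by gcongr
      _ = t := by field_simp
      _ ≤ 2 * γ := htγ
  have h₂ : t * Real.sqrt (γ / t) ≤ Real.sqrt 2 * γ := by
    refine (sq_le_sq₀ (by positivity) (by positivity)).mp ?_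
    rw [mul_pow, mul_pow, Real.sq_sqrt (by positivity), Real.sq_sqrt (by norm_num)]
    calc t ^ 2 * (γ / t) = t * γ := by field_simp
      _ ≤ 2 * γ * γ := by gcongr
      _ = 2 * γ ^ 2 := by ring
  linarith

theorem lemma_3_2 {d : ℕ} (hd : 0 < d) (γ : ℝ) (hγ0 : 0 < γ) (hγ : γ < 1 / 2)
    (μG : EuclideanSpace ℝ (Fin d))
    (S L S' : Multiset (EuclideanSpace ℝ (Fin d)))
    (hS : S ≠ 0) (hL : L ≠ 0) (hS' : S' ≠ 0)
    (hLS : Multiset.card L ≤ Multiset.card S)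
    (hL2γ : (Multiset.card L : ℝ) ≤ 2 * γ * (Multiset.card S : ℝ))
    (hcard : (1 - 2 * γ) * (Multiset.card S : ℝ) ≤ (Multiset.card S' : ℝ))
    (hmean : ‖emean L - μG‖
        ≤ Real.sqrt (Real.log ((Multiset.card S : ℝ) / (Multiset.card L : ℝ)))
          + Real.sqrt (γ * (Multiset.card S : ℝ) / (Multiset.card L : ℝ))) :
    ((Multiset.card L : ℝ) / (Multiset.card S' : ℝ)) * ‖emean L - μG‖
      ≤ (Real.sqrt 2 * γ + Real.sqrt (2 * γ)) / (1 - 2 * γ) := by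
  have hn : (0 : ℝ) < Multiset.card L := by exact_mod_cast Multiset.card_pos.mpr hL
  have hs : (0 : ℝ) < Multiset.card S := by exact_mod_cast Multiset.card_pos.mpr hS
  have hns : (Multiset.card L : ℝ) ≤ Multiset.card S := by exact_mod_cast hLS
  have hδ : 0 < 1 - 2 * γ := by linarith
  generalize (Multiset.card L : ℝ) = n at *
  generalize (Multiset.card S : ℝ) = s at *
  generalize (Multiset.card S' : ℝ) = p at *
  have key := mul_sqrt_log_inv_add_sqrt_div_le (div_pos hn hs) hγ0
    ((div_le_iff₀ hs).mpr hL2γ) ((div_le_one hs).mpr hns)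
  rw [inv_div, div_div_eq_mul_div] at key
  calc n / p * ‖emean L - μG‖
      ≤ n / ((1 - 2 * γ) * s)
          * (Real.sqrt (Real.log (s / n)) + Real.sqrt (γ * s / n)) := by gcongr
    _ = n / s * (Real.sqrt (Real.log (s / n)) + Real.sqrt (γ * s / n)) / (1 - 2 * γ) := by
        field_simp
    _ ≤ (Real.sqrt 2 * γ + Real.sqrt (2 * γ)) / (1 - 2 * γ) := by gcongr
end

section
/- (Abstract form of Lemma 3.3.) Let a, u, γ, κ, λ be real numbers with 0 < a, a ≤ 2γ, a ≤ 1/2, u ≥ 0, κ ≥ 0, λ ≥ 0, and suppose (a − a²)·u² − 2aκ·u ≤ λ + κ². Then a·u ≤ (2 + 2√γ)·κ + 2·√(γ·λ). -/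
theorem abstract_lemma_3_3 (a u γ κ l : ℝ)
    (ha0 : 0 < a) (haγ : a ≤ 2 * γ) (ha : a ≤ 1 / 2)
    (hu : 0 ≤ u) (hκ : 0 ≤ κ) (hl : 0 ≤ l)
    (h : (a - a ^ 2) * u ^ 2 - 2 * a * κ * u ≤ l + κ ^ 2) :
    a * u ≤ (2 + 2 * Real.sqrt γ) * κ + 2 * Real.sqrt (γ * l) := by
  have hγ : 0 ≤ γ := by linarith
  rw [Real.sqrt_mul hγ]
  have hs := Real.sqrt_nonneg γ
  have ht := Real.sqrt_nonneg l
  have hs2 := Real.sq_sqrt hγ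
  have ht2 := Real.sq_sqrt hl
  set s := √γ
  set t := √l
  by_contra! hx
  have hquad : a * u * ((1 - a) * (a * u) - 2 * a * κ) ≤ a * (t ^ 2 + κ ^ 2) := by
    rw [ht2]
    linarith [mul_le_mul_of_nonneg_left h ha0.le]
  have hfactor : s * (κ + t) < (1 - a) * (a * u) - 2 * a * κ := by
    have h₁ := mul_nonneg (sub_nonneg.2 ha) (mul_nonneg ha0.le hu)
    have h₂ := mul_nonneg (sub_nonneg.2 ha) hκ
    linarith
  have hprod := mul_lt_mul'' hx hfactor (by positivity) (by positivity)
  have hbound : a * (t ^ 2 + κ ^ 2) ≤ 2 * s ^ 2 * (t ^ 2 + κ ^ 2) := by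
    rw [hs2]
    gcongr
  have hcross : 0 ≤ 2 * s * κ ^ 2 + 2 * s * κ * t + 4 * s ^ 2 * κ * t := by positivity
  linarith
end
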